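/- Let (X,d) be a metric space with marked point p, and suppose every pretangent space Ω_{p,r̃}^X is separable and tangent. Then X is midpoint convex at p and liminf_{w,x,y,z→p} A₁(w,x,y,z) ≥ 0 if and only if every pretangent space Ω_{p,r̃}^X is a geodesic metric space whose metric ρ satisfies the quadrilateral inequality ρ²(α,γ)+ρ²(β,η) ≤ ρ²(α,β)+ρ²(β,γ)+ρ²(γ,η)+ρ²(η,α) for all α,β,γ,η (i.e., is a geodesic space of nonpositive Aleksandrov curvature). -/

import Mathlib

open Filter Topology

universe u

section Defs

variable {X : Type u} [MetricSpace X]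

/-- A normalizing sequence is a sequence of positive reals tending to zero. -/
def IsNormalizingSeq (r : ℕ → ℝ) : Prop :=
  (∀ n, 0 < r n) ∧ Tendsto r atTop (𝓝 0)

/-- Two sequences of points of `X` are mutually stable w.r.t. `r` if
`d(x_n, y_n)/r_n` converges to a finite limit. -/
def MutuallyStable (r : ℕ → ℝ) (x y : ℕ → X) : Prop :=
  ∃ L : ℝ, Tendsto (fun n => dist (x n) (y n) / r n) atTop (𝓝 L)

/-- A family of sequences is self-stable if any two members are mutually stable. -/
def SelfStable (r : ℕ → ℝ) (F : Set (ℕ → X)) : Prop :=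
  ∀ x ∈ F, ∀ y ∈ F, MutuallyStable r x y

/-- A maximal self-stable family containing the constant sequence `p`. -/
def MaximalSelfStable (p : X) (r : ℕ → ℝ) (F : Set (ℕ → X)) : Prop :=
  SelfStable r F ∧ (fun _ => p) ∈ F ∧
    ∀ G : Set (ℕ → X), SelfStable r G → F ⊆ G → G = F

/-- `(Ω, π)` is (a realization of) the pretangent space of `X` at `p`
with respect to the normalizing sequence `r` and the maximal self-stable family
`F`; the map `π` is the metric identification projection, so that the distance
in `Ω` between `π x` and `π y` is `lim_n d(x_n,y_n)/r_n`. -/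
def IsPretangentSpace (p : X) (r : ℕ → ℝ) (F : Set (ℕ → X))
    {Ω : Type u} [MetricSpace Ω] (π : (ℕ → X) → Ω) : Prop :=
  IsNormalizingSeq r ∧ MaximalSelfStable p r F ∧
    (∀ ω : Ω, ∃ x ∈ F, π x = ω) ∧
    ∀ x ∈ F, ∀ y ∈ F,
      Tendsto (fun n => dist (x n) (y n) / r n) atTop (𝓝 (dist (π x) (π y)))

/-- The pretangent space determined by the maximal self-stable family `F` is
tangent: for every strictly increasing sequence `φ` of naturals and every
maximal self-stable family `F'` w.r.t. `r ∘ φ` containing all `x ∘ φ` with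
`x ∈ F`, the canonical isometric embedding `em'` is bijective (being always an
isometric embedding it suffices that it be surjective, as stated here). -/
def IsTangentFamily (p : X) (r : ℕ → ℝ) (F : Set (ℕ → X)) : Prop :=
  ∀ φ : ℕ → ℕ, StrictMono φ →
    ∀ F' : Set (ℕ → X), MaximalSelfStable p (r ∘ φ) F' →
      (∀ x ∈ F, x ∘ φ ∈ F') →
      ∀ y ∈ F', ∃ x ∈ F,
        Tendsto (fun k => dist (x (φ k)) (y k) / r (φ k)) atTop (𝓝 0)

/-- `δ_p(w,x,y,z) = max_i d(x_i, p)`. -/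
noncomputable def delta4 (p w x y z : X) : ℝ :=
  max (dist w p) (max (dist x p) (max (dist y p) (dist z p)))

/-- `δ_p(x,y,z) = max_i d(x_i, p)`. -/
noncomputable def delta3 (p x y z : X) : ℝ :=
  max (dist x p) (max (dist y p) (dist z p))

open Classical in
/-- The function `A₁` of Berg–Nikolaev type. -/
noncomputable def A1 (p w x y z : X) : ℝ :=
  if w = p ∧ x = p ∧ y = p ∧ z = p then 0
  else (dist w x ^ 2 + dist x y ^ 2 + dist y z ^ 2 + dist z w ^ 2
          - dist w y ^ 2 - dist x z ^ 2) / delta4 p w x y z ^ 2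

open Classical in
/-- The function `A₂` of Lebedeva–Petrunin type. -/
noncomputable def A2 (p w x y z : X) : ℝ :=
  if w = p ∧ x = p ∧ y = p ∧ z = p then 0
  else (dist w x ^ 2 + dist w y ^ 2 + dist w z ^ 2
          - (dist x y ^ 2 + dist y z ^ 2 + dist z x ^ 2) / 3) / delta4 p w x y z ^ 2

open Classical in
/-- The function `A₃` of Ptolemy type. -/
noncomputable def A3 (p w x y z : X) : ℝ :=
  if w = p ∧ x = p ∧ y = p ∧ z = p then 0
  else (dist x w * dist y z + dist x z * dist y w - dist x y * dist w z)
          / delta4 p w x y z ^ 2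

open Classical in
/-- The quotient `|d(w,z) - d(x,y)/2| / δ_p(x,y)`, valued in `EReal`, with the
conventions: `0` if `x = y = p` and `z = p`, and `+∞` if `x = y = p` but `z ≠ p`. -/
noncomputable def midQuot (p w x y z : X) : EReal :=
  if x = p ∧ y = p then (if z = p then (0 : EReal) else ⊤)
  else ((|dist w z - dist x y / 2| / max (dist x p) (dist y p) : ℝ) : EReal)

/-- `z` is an infinitesimal midpoint of the sequences `x` and `y`. -/
def IsInfinitesimalMidpoint (p : X) (x y z : ℕ → X) : Prop :=
  Tendsto (fun n => midQuot p (x n) (x n) (y n) (z n)) atTop (𝓝 (0 : EReal)) ∧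
    Tendsto (fun n => midQuot p (y n) (x n) (y n) (z n)) atTop (𝓝 (0 : EReal))

/-- `X` is midpoint convex at the marked point `p`. -/
def MidpointConvexAt (p : X) : Prop :=
  ∀ x y : ℕ → X, Tendsto x atTop (𝓝 p) → Tendsto y atTop (𝓝 p) →
    ∃ z : ℕ → X, IsInfinitesimalMidpoint p x y z

/-- `X` is Busemann convex at the marked point `p`. -/
def BusemannConvexAt (p : X) : Prop :=
  MidpointConvexAt p ∧
    ∀ x0 x1 y m : ℕ → X, Tendsto x0 atTop (𝓝 p) → Tendsto x1 atTop (𝓝 p) →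
      Tendsto y atTop (𝓝 p) → IsInfinitesimalMidpoint p x0 x1 m →
      Tendsto (fun n =>
          max (dist (m n) (y n) - (dist (x0 n) (y n) + dist (x1 n) (y n)) / 2) 0
            / delta3 p (x0 n) (y n) (x1 n)) atTop (𝓝 (0 : ℝ))

end Defs

section MetricDefs

/-- `s` is a geodesic segment with endpoints `x` and `y`: a subset isometric to
the closed interval `[0, d(x,y)]`, the endpoints of the interval corresponding
to `x` and `y`. -/
def IsGeodesicSegment {Z : Type u} [MetricSpace Z] (s : Set Z) (x y : Z) : Prop :=
  ∃ f : ℝ → Z,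
    (∀ a ∈ Set.Icc 0 (dist x y), ∀ b ∈ Set.Icc 0 (dist x y),
      dist (f a) (f b) = |a - b|) ∧
    f '' Set.Icc 0 (dist x y) = s ∧ f 0 = x ∧ f (dist x y) = y

/-- A metric space is geodesic if any two points are the endpoints of some
geodesic segment. -/
def IsGeodesicSpace (Y : Type u) [MetricSpace Y] : Prop :=
  ∀ x y : Y, ∃ s : Set Y, IsGeodesicSegment s x y

/-- `m` is a midpoint of `x` and `y`. -/
def IsMidpointOf {Z : Type u} [MetricSpace Z] (m x y : Z) : Prop :=
  dist m x = dist x y / 2 ∧ dist m y = dist x y / 2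

/-- An affinely parametrized geodesic `γ : [a,b] → Z`:
`d(γ s, γ t) = λ |s - t|` for some constant `λ ≥ 0`. -/
def IsAffineGeodesic {Z : Type u} [MetricSpace Z] (γ : ℝ → Z) (a b : ℝ) : Prop :=
  ∃ lam : ℝ, 0 ≤ lam ∧ ∀ s ∈ Set.Icc a b, ∀ t ∈ Set.Icc a b,
    dist (γ s) (γ t) = lam * |s - t|

/-- Busemann convexity of a (geodesic) metric space: for any two affinely
parametrized geodesics the joint distance function is convex. -/
def BusemannConvex (Y : Type u) [MetricSpace Y] : Prop :=
  ∀ (a b a' b' : ℝ) (γ γ' : ℝ → Y), IsAffineGeodesic γ a b →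
    IsAffineGeodesic γ' a' b' →
    ConvexOn ℝ (Set.Icc a b ×ˢ Set.Icc a' b')
      (fun q : ℝ × ℝ => dist (γ q.1) (γ' q.2))

/-- A metric space is Ptolemaic if the Ptolemy inequality holds. -/
def Ptolemaic (Y : Type u) [MetricSpace Y] : Prop :=
  ∀ x y u v : Y, dist x y * dist u v ≤ dist x u * dist y v + dist x v * dist y u

end MetricDefs

section Helpers

variable {X : Type u} [MetricSpace X]

lemma aux_zorn (p : X) (r : ℕ → ℝ) (F0 : Set (ℕ → X)) (h : SelfStable r F0)
    (hp : (fun _ => p) ∈ F0) : ∃ F, F0 ⊆ F ∧ MaximalSelfStable p r F := by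
  obtain ⟨F, hF, hmax⟩ := zorn_subset_nonempty {F : Set (ℕ → X) | SelfStable r F}
    (by
      intro c hc hchain _
      refine ⟨⋃₀ c, ?_, fun s hs => Set.subset_sUnion_of_mem hs⟩
      rintro x ⟨s, hs, hxs⟩ y ⟨t, ht, hyt⟩
      rcases hchain.total hs ht with hst | hst
      · exact hc ht x (hst hxs) y hyt
      · exact hc hs x hxs y (hst hyt)) F0 h
  refine ⟨F, hF, hmax.prop, hF hp, fun G hG hFG => ?_⟩
  exact Set.Subset.antisymm (hmax.le_of_ge hG hFG) hFG

lemma aux_symm {r : ℕ → ℝ} {x y : ℕ → X} (h : MutuallyStable r x y) : MutuallyStable r y x := by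
  obtain ⟨L, hL⟩ := h
  exact ⟨L, by simpa only [dist_comm] using hL⟩

lemma aux_self (r : ℕ → ℝ) (x : ℕ → X) : MutuallyStable r x x := ⟨0, by simp⟩

lemma aux_insert {r : ℕ → ℝ} {F : Set (ℕ → X)} (hF : SelfStable r F) {y : ℕ → X}
    (hy : ∀ x ∈ F, MutuallyStable r y x) : SelfStable r (insert y F) := by
  rintro a (rfl | ha) b (rfl | hb)
  · exact aux_self _ _
  · exact hy b hb
  · exact aux_symm (hy a ha)
  · exact hF a ha b hb

lemma aux_mem {p : X} {r : ℕ → ℝ} {F : Set (ℕ → X)} (hF : MaximalSelfStable p r F) {y : ℕ → X}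
    (hy : ∀ x ∈ F, MutuallyStable r y x) : y ∈ F := by
  have := hF.2.2 _ (aux_insert hF.1 hy) (Set.subset_insert _ _)
  rw [← this]
  exact Set.mem_insert _ _

lemma aux_quot (S : Type u) (D : S → S → ℝ) (h0 : ∀ a, D a a = 0) (hc : ∀ a b, D a b = D b a)
    (ht : ∀ a b c, D a c ≤ D a b + D b c) :
    ∃ (Ω : Type u) (_ : MetricSpace Ω) (q : S → Ω), Function.Surjective q ∧
      ∀ a b, dist (q a) (q b) = D a b := by
  let _ : PseudoMetricSpace S :=
    { dist := D
      dist_self := h0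
      dist_comm := hc
      dist_triangle := ht }
  exact ⟨SeparationQuotient S, inferInstance, SeparationQuotient.mk,
    SeparationQuotient.surjective_mk, fun a b => SeparationQuotient.dist_mk a b⟩

lemma aux_exists {p : X} {r : ℕ → ℝ} {F : Set (ℕ → X)} (hr : IsNormalizingSeq r)
    (hF : MaximalSelfStable p r F) :
    ∃ (Ω : Type u) (_ : MetricSpace Ω) (π : (ℕ → X) → Ω), IsPretangentSpace p r F π := by
  classical
  have key : ∀ x y : F, ∃ L : ℝ, Tendsto (fun n => dist (x.1 n) (y.1 n) / r n) atTop (𝓝 L) :=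
    fun x y => hF.1 x x.2 y y.2
  choose D hD using key
  obtain ⟨Ω, hΩ, q, hq, hqd⟩ := aux_quot F D
    (fun x => tendsto_nhds_unique (hD x x) (by simp))
    (fun x y => tendsto_nhds_unique (hD x y)
        (by simpa only [dist_comm] using hD y x))
    (fun x y z => by
        refine le_of_tendsto_of_tendsto' (hD x z) ((hD x y).add (hD y z)) fun n => ?_
        rw [← add_div]
        exact div_le_div_of_nonneg_right (dist_triangle _ _ _) (hr.1 n).le)
  refine ⟨Ω, hΩ,
    fun x => if h : x ∈ F then q ⟨x, h⟩ else q ⟨_, hF.2.1⟩, hr, hF, ?_, ?_⟩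
  · intro ω
    obtain ⟨x, rfl⟩ := hq ω
    exact ⟨x.1, x.2, by simp⟩
  · intro x hx y hy
    simp only [hx, hy, dif_pos, hqd]
    exact hD ⟨x, hx⟩ ⟨y, hy⟩

lemma aux_subseq {ι : Type*} [Countable ι] (a : ι → ℕ → ℝ)
    (h : ∀ i, ∃ M, ∀ n, |a i n| ≤ M) :
    ∃ φ : ℕ → ℕ, StrictMono φ ∧ ∀ i, ∃ L, Tendsto (fun k => a i (φ k)) atTop (𝓝 L) := by
  choose M hM using h
  have hc : IsCompact (Set.univ.pi fun i => Set.Icc (-(M i)) (M i)) :=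
    isCompact_univ_pi fun i => isCompact_Icc
  obtain ⟨L, -, φ, hφ, hL⟩ := hc.tendsto_subseq (x := fun n i => a i n)
    (fun n i _ => abs_le.1 (hM i n))
  exact ⟨φ, hφ, fun i => ⟨L i, (tendsto_pi_nhds.1 hL) i⟩⟩

lemma aux_norm_comp {r : ℕ → ℝ} (hr : IsNormalizingSeq r) {φ : ℕ → ℕ} (hφ : StrictMono φ) :
    IsNormalizingSeq (r ∘ φ) := ⟨fun n => hr.1 _, hr.2.comp hφ.tendsto_atTop⟩

lemma aux_pret {ι : Type*} [Countable ι] (p : X) (v : ι → ℕ → X) (r : ℕ → ℝ)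
    (hr : IsNormalizingSeq r) (hv : ∀ i n, dist (v i n) p ≤ r n) :
    ∃ φ : ℕ → ℕ, StrictMono φ ∧ ∃ (F : Set (ℕ → X)) (Ω : Type u) (_ : MetricSpace Ω)
      (π : (ℕ → X) → Ω), IsPretangentSpace p (r ∘ φ) F π ∧ ∀ i, v i ∘ φ ∈ F := by
  let v' : Option ι → ℕ → X := fun o => o.elim (fun _ => p) v
  have hv' : ∀ i n, dist (v' i n) p ≤ r n := by
    rintro (_ | i) n
    · simpa [v'] using (hr.1 n).le
    · exact hv i n
  obtain ⟨φ, hφ, hL⟩ := aux_subseq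
    (fun (ij : Option ι × Option ι) n => dist (v' ij.1 n) (v' ij.2 n) / r n)
    (fun ij => ⟨2, fun n => by
      rw [abs_of_nonneg (div_nonneg dist_nonneg (hr.1 n).le), div_le_iff₀ (hr.1 n)]
      linarith [dist_triangle_right (v' ij.1 n) (v' ij.2 n) p, hv' ij.1 n, hv' ij.2 n]⟩)
  obtain ⟨F, hF0, hF⟩ := aux_zorn p (r ∘ φ) (Set.range fun i => v' i ∘ φ)
    (by
      rintro _ ⟨i, rfl⟩ _ ⟨j, rfl⟩
      exact hL (i, j)) ⟨none, rfl⟩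
  obtain ⟨Ω, hΩ, π, hπ⟩ := aux_exists (aux_norm_comp hr hφ) hF
  exact ⟨φ, hφ, F, Ω, hΩ, π, hπ, fun i => hF0 ⟨some i, rfl⟩⟩

lemma aux_approx (a : ℕ → ℝ) (h : ∀ ε > 0, ∃ b : ℕ → ℝ, (∃ L, Tendsto b atTop (𝓝 L)) ∧
    ∀ᶠ n in atTop, |a n - b n| ≤ ε) : ∃ L, Tendsto a atTop (𝓝 L) := by
  apply cauchySeq_tendsto_of_complete
  rw [Metric.cauchySeq_iff]
  intro ε hε
  obtain ⟨b, ⟨L, hL⟩, hb⟩ := h (ε / 4) (by positivity)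
  obtain ⟨N, hN⟩ := Metric.cauchySeq_iff.1 hL.cauchySeq (ε / 4) (by positivity)
  obtain ⟨N', hN'⟩ := eventually_atTop.1 hb
  refine ⟨max N N', fun m hm n hn => ?_⟩
  have h1 := hN m (le_trans (le_max_left _ _) hm) n (le_trans (le_max_left _ _) hn)
  have h2 := abs_le.1 (hN' m (le_trans (le_max_right _ _) hm))
  have h3 := abs_le.1 (hN' n (le_trans (le_max_right _ _) hn))
  rw [Real.dist_eq, abs_lt] at *
  constructor <;> linarith [h1.1, h1.2, h2.1, h2.2, h3.1, h3.2]

lemma aux_diag (P : ℕ → ℕ → Prop) (h : ∀ k, ∀ᶠ n in atTop, P k n) :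
    ∃ j : ℕ → ℕ, Tendsto j atTop atTop ∧ ∀ᶠ n in atTop, P (j n) n := by
  classical
  refine ⟨fun n => Nat.findGreatest (fun k => P k n) n, ?_, ?_⟩
  · rw [tendsto_atTop]
    intro K
    filter_upwards [h K, eventually_ge_atTop K] with n h1 h2
    exact Nat.le_findGreatest h2 h1
  · filter_upwards [h 0] with n hn
    exact Nat.findGreatest_spec (P := fun k => P k n) (Nat.zero_le n) hn

lemma aux_tri {r : ℝ} (hr : 0 < r) (x y z : X) :
    |dist y z / r - dist x z / r| ≤ dist y x / r := by
  rw [← sub_div, abs_div, abs_of_pos hr]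
  exact div_le_div_of_nonneg_right (abs_dist_sub_le y x z) hr.le

lemma aux_complete {p : X} {r : ℕ → ℝ} {F : Set (ℕ → X)} {Ω : Type u} [MetricSpace Ω]
    {π : (ℕ → X) → Ω} (hπ : IsPretangentSpace p r F π) : CompleteSpace Ω := by
  obtain ⟨hr, hF, hs, hd⟩ := hπ
  apply Metric.complete_of_cauchySeq_tendsto
  intro ω hω
  choose x hxF hx using fun i => hs (ω i)
  have hdx : ∀ i j, Tendsto (fun n => dist (x i n) (x j n) / r n) atTop
      (𝓝 (dist (ω i) (ω j))) := fun i j => by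
    have := hd _ (hxF i) _ (hxF j)
    rwa [hx, hx] at this
  obtain ⟨j, hj, hP⟩ := aux_diag
    (fun k n => ∀ i ∈ Finset.range (k + 1),
      dist (x k n) (x i n) / r n < dist (ω k) (ω i) + 1 / ((k : ℝ) + 1))
    (fun k => by
      rw [Filter.eventually_all_finset]
      intro i _
      refine (hdx k i).eventually (gt_mem_nhds ?_)
      have : 0 < 1 / ((k : ℝ) + 1) := by positivity
      linarith)
  have hclose : ∀ ε > 0, ∃ N0, ∀ N ≥ N0,
      ∀ᶠ n in atTop, dist (x (j n) n) (x N n) / r n ≤ ε := by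
    intro ε hε
    obtain ⟨N0, hN0⟩ := Metric.cauchySeq_iff.1 hω (ε / 2) (by positivity)
    refine ⟨N0, fun N hN => ?_⟩
    have h1 : ∀ᶠ k : ℕ in atTop, 1 / ((k : ℝ) + 1) < ε / 2 :=
      tendsto_one_div_add_atTop_nhds_zero_nat.eventually (gt_mem_nhds (by positivity))
    filter_upwards [hP, hj.eventually h1, hj.eventually (eventually_ge_atTop N)] with n a b c
    have := a N (Finset.mem_range.2 (by omega))
    have := hN0 (j n) (le_trans hN c) N hN
    linarith
  have hy : (fun n => x (j n) n) ∈ F := by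
    apply aux_mem hF
    intro x0 hx0
    apply aux_approx
    intro ε hε
    obtain ⟨N0, hN0⟩ := hclose ε hε
    refine ⟨_, hF.1 (x N0) (hxF N0) x0 hx0, ?_⟩
    filter_upwards [hN0 N0 le_rfl] with n hn
    exact (aux_tri (hr.1 n) _ _ _).trans hn
  refine ⟨π (fun n => x (j n) n), ?_⟩
  rw [Metric.tendsto_atTop]
  intro ε hε
  obtain ⟨N0, hN0⟩ := hclose (ε / 2) (by positivity)
  refine ⟨N0, fun N hN => ?_⟩
  have := le_of_tendsto (hd _ hy _ (hxF N)) (hN0 N hN)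
  rw [hx, dist_comm] at this
  linarith

lemma aux_menger {Z : Type u} [MetricSpace Z] [CompleteSpace Z]
    (hm : ∀ x y : Z, ∃ m, dist m x = dist x y / 2 ∧ dist m y = dist x y / 2) :
    IsGeodesicSpace Z := by
  intro x y
  set L := dist x y with hLdef
  have hL : 0 ≤ L := dist_nonneg
  let good : Set (Set (ℝ × Z)) := {G | ∀ u ∈ G, u.1 ∈ Set.Icc 0 L ∧
    ∀ v ∈ G, dist u.2 v.2 = |u.1 - v.1|}
  obtain ⟨G, hG0, hmax⟩ := zorn_subset_nonempty good
    (by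
      intro c hc hchain _
      refine ⟨⋃₀ c, ?_, fun s hs => Set.subset_sUnion_of_mem hs⟩
      rintro a ⟨s, hs, has⟩
      refine ⟨(hc hs a has).1, ?_⟩
      rintro b ⟨t, ht, hbt⟩
      rcases hchain.total hs ht with hst | hst
      · exact (hc ht a (hst has)).2 b hbt
      · exact (hc hs a has).2 b (hst hbt)) {((0 : ℝ), x), (L, y)}
    (by
      rintro u (rfl | rfl)
      · refine ⟨⟨le_rfl, hL⟩, ?_⟩
        rintro v (rfl | rfl)
        · simp
        · simp only [zero_sub, abs_neg, abs_of_nonneg hL]; rfl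
      · refine ⟨⟨hL, le_rfl⟩, ?_⟩
        rintro v (rfl | rfl)
        · simp only [sub_zero, abs_of_nonneg hL, dist_comm y x]; rfl
        · simp)
  have hG : ∀ u ∈ G, u.1 ∈ Set.Icc 0 L ∧ ∀ v ∈ G, dist u.2 v.2 = |u.1 - v.1| := hmax.prop
  -- adding a point
  have hadd : ∀ t ∈ Set.Icc 0 L, ∀ z : Z, (∀ u ∈ G, dist z u.2 = |t - u.1|) → (t, z) ∈ G := by
    intro t ht z hz
    have hg : insert (t, z) G ∈ good := by
      rintro u (rfl | hu)
      · refine ⟨ht, ?_⟩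
        rintro v (rfl | hv)
        · simp
        · exact hz v hv
      · refine ⟨(hG u hu).1, ?_⟩
        rintro v (rfl | hv)
        · rw [dist_comm, abs_sub_comm]; exact hz u hu
        · exact (hG u hu).2 v hv
    exact hmax.le_of_ge hg (Set.subset_insert _ _) (Set.mem_insert _ _)
  have hclosed : IsClosed (Prod.fst '' G) := by
    rw [← closure_subset_iff_isClosed]
    intro t ht
    obtain ⟨s, hs, hst⟩ := mem_closure_iff_seq_limit.1 ht
    choose g hgG hg using hs
    have hC : CauchySeq fun n => (g n).2 := by
      rw [Metric.cauchySeq_iff]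
      intro ε hε
      obtain ⟨N, hN⟩ := Metric.cauchySeq_iff.1 hst.cauchySeq ε hε
      refine ⟨N, fun m hm n hn => ?_⟩
      rw [(hG _ (hgG m)).2 _ (hgG n), hg, hg, ← Real.dist_eq]
      exact hN m hm n hn
    obtain ⟨z, hz⟩ := cauchySeq_tendsto_of_complete hC
    refine ⟨(t, z), hadd t ?_ z ?_, rfl⟩
    · refine isClosed_Icc.mem_of_tendsto hst (Eventually.of_forall fun n => ?_)
      rw [← hg n]
      exact (hG _ (hgG n)).1
    · intro u hu
      refine tendsto_nhds_unique (hz.dist tendsto_const_nhds)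
        (((hst.sub tendsto_const_nhds).abs).congr fun n => ?_)
      rw [(hG _ (hgG n)).2 u hu, hg]
  have hall : ∀ t ∈ Set.Icc 0 L, ∃ z, (t, z) ∈ G := by
    intro t ht
    by_contra hno
    have hcA : IsCompact (Prod.fst '' G ∩ Set.Icc 0 t) := isCompact_Icc.inter_left hclosed
    have hcB : IsCompact (Prod.fst '' G ∩ Set.Icc t L) := isCompact_Icc.inter_left hclosed
    obtain ⟨a, ⟨⟨⟨a, za⟩, haG, rfl⟩, ha⟩, haub⟩ := hcA.exists_isGreatest
      ⟨0, ⟨(0, x), hG0 (by simp), rfl⟩, le_rfl, ht.1⟩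
    obtain ⟨b, ⟨⟨⟨b, zb⟩, hbG, rfl⟩, hb⟩, hblb⟩ := hcB.exists_isLeast
      ⟨L, ⟨(L, y), hG0 (by simp), rfl⟩, ht.2, le_rfl⟩
    simp only at ha haub hb hblb
    have hat : a < t := lt_of_le_of_ne ha.2 (by rintro rfl; exact hno ⟨_, haG⟩)
    have htb : t < b := lt_of_le_of_ne hb.1 (by rintro rfl; exact hno ⟨_, hbG⟩)
    have hgap : ∀ u ∈ G, u.1 ≤ a ∨ b ≤ u.1 := by
      intro u hu
      rcases le_total u.1 t with h | h
      · exact Or.inl (haub ⟨⟨u, hu, rfl⟩, (hG u hu).1.1, h⟩)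
      · exact Or.inr (hblb ⟨⟨u, hu, rfl⟩, h, (hG u hu).1.2⟩)
    obtain ⟨m, hma, hmb⟩ := hm za zb
    have hab : dist za zb = b - a := by
      rw [(hG _ haG).2 _ hbG, abs_sub_comm, abs_of_nonneg (by simp only; linarith)]
    have hin : ((a + b) / 2, m) ∈ G := by
      apply hadd
      · exact ⟨by linarith [ha.1], by linarith [hb.2]⟩
      · intro u hu
        have e1 := (hG _ haG).2 u hu
        have e2 := (hG _ hbG).2 u hu
        have t1 := dist_triangle m za u.2
        have t2 := dist_triangle m zb u.2
        have t3 := dist_triangle za m u.2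
        have t4 := dist_triangle zb m u.2
        rw [dist_comm za m] at t3
        rw [dist_comm zb m] at t4
        simp only at e1 e2
        rcases hgap u hu with h | h
        · rw [abs_of_nonneg (by linarith)] at e1 e2 ⊢
          linarith
        · rw [abs_of_nonpos (by linarith)] at e1 e2 ⊢
          linarith
    rcases hgap _ hin with h | h <;> simp only at h <;> linarith
  classical
  have : Nonempty Z := ⟨x⟩
  choose! f hf using hall
  have h0 : f 0 = x := by
    have := (hG _ (hf 0 ⟨le_rfl, hL⟩)).2 (0, x) (hG0 (by simp))
    simpa using this
  have h1 : f L = y := by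
    have := (hG _ (hf L ⟨hL, le_rfl⟩)).2 (L, y) (hG0 (by simp))
    simpa using this
  exact ⟨f '' Set.Icc 0 L, f, fun a ha b hb => (hG _ (hf a ha)).2 _ (hf b hb), rfl, h0, h1⟩

end Helpers

section Helpers2

variable {X : Type u} [MetricSpace X]

lemma aux_tendsto_p {p : X} {r : ℕ → ℝ} {F : Set (ℕ → X)} (hr : IsNormalizingSeq r)
    (hF : MaximalSelfStable p r F) {x : ℕ → X} (hx : x ∈ F) : Tendsto x atTop (𝓝 p) := by
  obtain ⟨L, hL⟩ := hF.1 x hx _ hF.2.1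
  rw [tendsto_iff_dist_tendsto_zero]
  have := hL.mul hr.2
  rw [mul_zero] at this
  refine this.congr fun n => ?_
  exact div_mul_cancel₀ _ (hr.1 n).ne'

lemma aux_mid_tendsto {p : X} {r : ℕ → ℝ} (hr : IsNormalizingSeq r) {x y z w : ℕ → X} {M ρ : ℝ}
    (hM : 0 < M)
    (hmax : Tendsto (fun n => max (dist (x n) p) (dist (y n) p) / r n) atTop (𝓝 M))
    (hρ : Tendsto (fun n => dist (x n) (y n) / r n) atTop (𝓝 ρ))
    (hq : Tendsto (fun n => midQuot p (w n) (x n) (y n) (z n)) atTop (𝓝 (0 : EReal))) :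
    Tendsto (fun n => dist (w n) (z n) / r n) atTop (𝓝 (ρ / 2)) := by
  have hpos : ∀ᶠ n in atTop, 0 < max (dist (x n) p) (dist (y n) p) := by
    filter_upwards [hmax.eventually (lt_mem_nhds hM)] with n hn
    by_contra hneg
    exact absurd hn (not_lt.2 (div_nonpos_of_nonpos_of_nonneg (not_lt.1 hneg) (hr.1 n).le))
  have h1 : Tendsto (fun n => ((|dist (w n) (z n) - dist (x n) (y n) / 2| /
      max (dist (x n) p) (dist (y n) p) : ℝ) : EReal)) atTop (𝓝 ((0 : ℝ) : EReal)) := by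
    refine Tendsto.congr' ?_ hq
    filter_upwards [hpos] with n hn
    rw [midQuot, if_neg]
    rintro ⟨h1, h2⟩
    simp [h1, h2] at hn
  rw [EReal.tendsto_coe] at h1
  have h2 := h1.mul hmax
  rw [zero_mul] at h2
  have h3 : Tendsto (fun n => |dist (w n) (z n) / r n - dist (x n) (y n) / r n / 2|)
      atTop (𝓝 0) := by
    refine Tendsto.congr' ?_ h2
    filter_upwards [hpos] with n hn
    have hrn := hr.1 n
    rw [div_mul_div_cancel₀ hn.ne']
    rw [← abs_of_pos hrn, ← abs_div, abs_of_pos hrn]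
    congr 1
    ring
  have h4 := (tendsto_zero_iff_abs_tendsto_zero _).2 h3
  have h5 := h4.add (hρ.div_const 2)
  rw [zero_add] at h5
  exact h5.congr fun n => by ring

lemma aux_midpoint {p : X} {r : ℕ → ℝ} {F : Set (ℕ → X)} {Ω : Type u} [MetricSpace Ω]
    {π : (ℕ → X) → Ω} (hπ : IsPretangentSpace p r F π) (hmc : MidpointConvexAt p)
    (hsep : TopologicalSpace.SeparableSpace Ω) (htan : IsTangentFamily p r F) (α β : Ω) :
    ∃ m, dist m α = dist α β / 2 ∧ dist m β = dist α β / 2 := by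
  by_cases hαβ : α = β
  · exact ⟨α, by simp [hαβ], by simp [hαβ]⟩
  obtain ⟨hr, hF, hs, hd⟩ := hπ
  obtain ⟨x, hxF, rfl⟩ := hs α
  obtain ⟨y, hyF, rfl⟩ := hs β
  obtain ⟨z, hzx, hzy⟩ := hmc x y (aux_tendsto_p hr hF hxF) (aux_tendsto_p hr hF hyF)
  set o := π (fun _ => p)
  have hmax : Tendsto (fun n => max (dist (x n) p) (dist (y n) p) / r n) atTop
      (𝓝 (max (dist (π x) o) (dist (π y) o))) := by
    refine ((hd x hxF _ hF.2.1).max (hd y hyF _ hF.2.1)).congr fun n => ?_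
    exact max_div_div_right (hr.1 n).le _ _
  have hM : 0 < max (dist (π x) o) (dist (π y) o) := by
    by_contra hneg
    have h1 : dist (π x) o ≤ 0 := (le_max_left _ _).trans (not_lt.1 hneg)
    have h2 : dist (π y) o ≤ 0 := (le_max_right _ _).trans (not_lt.1 hneg)
    exact hαβ ((dist_le_zero.1 h1).trans (dist_le_zero.1 h2).symm)
  have hxz := aux_mid_tendsto hr hM hmax (hd x hxF y hyF) hzx
  have hyz := aux_mid_tendsto hr hM hmax (hd x hxF y hyF) hzy
  -- dense sequence
  have : Nonempty Ω := ⟨o⟩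
  choose u huF hu using fun i => hs (TopologicalSpace.denseSeq Ω i)
  obtain ⟨φ, hφ, hconv⟩ := aux_subseq (fun i n => dist (z n) (u i n) / r n) (fun i => by
    obtain ⟨A, hA⟩ := hxz.bddAbove_range
    obtain ⟨B, hB⟩ := (hd x hxF (u i) (huF i)).bddAbove_range
    refine ⟨A + B, fun n => ?_⟩
    rw [abs_of_nonneg (div_nonneg dist_nonneg (hr.1 n).le)]
    have h1 : dist (x n) (z n) / r n ≤ A := hA ⟨n, rfl⟩
    have h2 : dist (x n) (u i n) / r n ≤ B := hB ⟨n, rfl⟩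
    refine le_trans ?_ (add_le_add h1 h2)
    rw [← add_div]
    exact div_le_div_of_nonneg_right (dist_triangle_left _ _ _) (hr.1 n).le)
  have hφt := hφ.tendsto_atTop
  set F0 : Set (ℕ → X) := (fun v => v ∘ φ) '' F
  have hF0 : SelfStable (r ∘ φ) F0 := by
    rintro _ ⟨a, ha, rfl⟩ _ ⟨b, hb, rfl⟩
    exact ⟨_, (hd a ha b hb).comp hφt⟩
  have hz0 : ∀ v ∈ F0, MutuallyStable (r ∘ φ) (z ∘ φ) v := by
    rintro _ ⟨a, ha, rfl⟩
    apply aux_approx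
    intro ε hε
    obtain ⟨i, hi⟩ := (TopologicalSpace.denseRange_denseSeq Ω).exists_dist_lt (π a) hε
    refine ⟨_, hconv i, ?_⟩
    have h1 := hd a ha (u i) (huF i)
    rw [hu] at h1
    filter_upwards [hφt.eventually (h1.eventually (gt_mem_nhds hi))] with n hn
    have h2 := aux_tri (hr.1 (φ n)) (u i (φ n)) (a (φ n)) (z (φ n))
    rw [dist_comm _ (z (φ n)), dist_comm _ (z (φ n))] at h2
    exact h2.trans hn.le
  obtain ⟨F', hF', hmaxF'⟩ := aux_zorn p (r ∘ φ) _ (aux_insert hF0 hz0)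
    (Set.mem_insert_of_mem _ ⟨_, hF.2.1, rfl⟩)
  obtain ⟨m, hm, hmz⟩ := htan φ hφ F' hmaxF'
    (fun v hv => hF' (Set.mem_insert_of_mem _ ⟨v, hv, rfl⟩)) (z ∘ φ)
    (hF' (Set.mem_insert _ _))
  have hfin : ∀ v ∈ F, ∀ c, Tendsto (fun n => dist (v n) (z n) / r n) atTop (𝓝 c) →
      dist (π m) (π v) = c := by
    intro v hv c hc
    refine tendsto_nhds_unique ((hd m hm v hv).comp hφt) ?_
    have h1 : Tendsto (fun k => dist (m (φ k)) (v (φ k)) / r (φ k) -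
        dist (v (φ k)) (z (φ k)) / r (φ k)) atTop (𝓝 0) := by
      refine squeeze_zero_norm (fun k => ?_) hmz
      rw [Real.norm_eq_abs, dist_comm (v (φ k)) (z (φ k))]
      exact aux_tri (hr.1 _) _ _ _
    have h2 := h1.add (hc.comp hφt)
    rw [zero_add] at h2
    exact h2.congr fun k => by simp
  exact ⟨π m, hfin x hxF _ hxz, hfin y hyF _ hyz⟩

lemma aux_delta_nonneg (p w x y z : X) : 0 ≤ delta4 p w x y z :=
  dist_nonneg.trans (le_max_left _ _)

lemma aux_delta_le (p w x y z : X) : dist w p ≤ delta4 p w x y z ∧ dist x p ≤ delta4 p w x y z ∧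
    dist y p ≤ delta4 p w x y z ∧ dist z p ≤ delta4 p w x y z := by
  unfold delta4
  exact ⟨le_max_left _ _, by simp, by simp, by simp⟩

lemma aux_delta_pos {p w x y z : X} (h : ¬(w = p ∧ x = p ∧ y = p ∧ z = p)) :
    0 < delta4 p w x y z := by
  by_contra hneg
  obtain ⟨h1, h2, h3, h4⟩ := aux_delta_le p w x y z
  have h0 := not_lt.1 hneg
  exact h ⟨dist_le_zero.1 (h1.trans h0), dist_le_zero.1 (h2.trans h0),
    dist_le_zero.1 (h3.trans h0), dist_le_zero.1 (h4.trans h0)⟩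

lemma aux_A1_bound (p w x y z : X) : -16 ≤ A1 p w x y z ∧ A1 p w x y z ≤ 16 := by
  unfold A1
  split_ifs with h
  · norm_num
  have hδ := aux_delta_pos h
  obtain ⟨h1, h2, h3, h4⟩ := aux_delta_le p w x y z
  set δ := delta4 p w x y z
  have key : ∀ a b : X, dist a p ≤ δ → dist b p ≤ δ → dist a b ^ 2 ≤ 4 * δ ^ 2 := by
    intro a b ha hb
    have : dist a b ≤ 2 * δ := by linarith [dist_triangle_right a b p]
    calc dist a b ^ 2 ≤ (2 * δ) ^ 2 := by gcongr
      _ = _ := by ring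
  rw [le_div_iff₀ (by positivity), div_le_iff₀ (by positivity)]
  have k1 := key w x h1 h2
  have k2 := key x y h2 h3
  have k3 := key y z h3 h4
  have k4 := key z w h4 h1
  have k5 := key w y h1 h3
  have k6 := key x z h2 h4
  constructor <;> nlinarith [sq_nonneg (dist w x), sq_nonneg (dist x y), sq_nonneg (dist y z),
    sq_nonneg (dist z w), sq_nonneg (dist w y), sq_nonneg (dist x z)]

lemma aux_liminf (p : X) :
    0 ≤ liminf (fun q : X × X × X × X => A1 p q.1 q.2.1 q.2.2.1 q.2.2.2) (𝓝 (p, p, p, p)) ↔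
      ∀ b < 0, ∀ᶠ q : X × X × X × X in 𝓝 (p, p, p, p), b ≤ A1 p q.1 q.2.1 q.2.2.1 q.2.2.2 := by
  have hB : IsBoundedUnder (· ≥ ·) (𝓝 (p, p, p, p))
      (fun q : X × X × X × X => A1 p q.1 q.2.1 q.2.2.1 q.2.2.2) :=
    isBoundedUnder_of ⟨-16, fun q => (aux_A1_bound _ _ _ _ _).1⟩
  have hC : IsBoundedUnder (· ≤ ·) (𝓝 (p, p, p, p))
      (fun q : X × X × X × X => A1 p q.1 q.2.1 q.2.2.1 q.2.2.2) :=
    isBoundedUnder_of ⟨16, fun q => (aux_A1_bound _ _ _ _ _).2⟩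
  constructor
  · intro h b hb
    exact (eventually_lt_of_lt_liminf (lt_of_lt_of_le hb h) hB).mono fun q hq => le_of_lt hq
  · intro h
    refine le_of_forall_lt_imp_le_of_dense fun b hb => ?_
    exact le_liminf_of_le hC.isCoboundedUnder_ge (h b hb)

lemma aux_quad {p : X} {r : ℕ → ℝ} {F : Set (ℕ → X)} {Ω : Type u} [MetricSpace Ω]
    {π : (ℕ → X) → Ω} (hπ : IsPretangentSpace p r F π) {w x y z : ℕ → X}
    (hw : w ∈ F) (hx : x ∈ F) (hy : y ∈ F) (hz : z ∈ F) :
    Tendsto (fun n => (dist (w n) (x n) ^ 2 + dist (x n) (y n) ^ 2 + dist (y n) (z n) ^ 2 +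
      dist (z n) (w n) ^ 2 - dist (w n) (y n) ^ 2 - dist (x n) (z n) ^ 2) / r n ^ 2) atTop
      (𝓝 (dist (π w) (π x) ^ 2 + dist (π x) (π y) ^ 2 + dist (π y) (π z) ^ 2 +
      dist (π z) (π w) ^ 2 - dist (π w) (π y) ^ 2 - dist (π x) (π z) ^ 2)) := by
  obtain ⟨hr, hF, hs, hd⟩ := hπ
  have := (((((hd w hw x hx).pow 2).add ((hd x hx y hy).pow 2)).add ((hd y hy z hz).pow 2)).add
    ((hd z hz w hw).pow 2)).sub ((hd w hw y hy).pow 2) |>.sub ((hd x hx z hz).pow 2)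
  refine this.congr fun n => ?_
  simp only [div_pow]
  ring

lemma aux_forward_quad {p : X} {r : ℕ → ℝ} {F : Set (ℕ → X)} {Ω : Type u} [MetricSpace Ω]
    {π : (ℕ → X) → Ω} (hπ : IsPretangentSpace p r F π)
    (hA : ∀ b < 0, ∀ᶠ q : X × X × X × X in 𝓝 (p, p, p, p), b ≤ A1 p q.1 q.2.1 q.2.2.1 q.2.2.2)
    (α β γ η : Ω) : dist α γ ^ 2 + dist β η ^ 2 ≤
            dist α β ^ 2 + dist β γ ^ 2 + dist γ η ^ 2 + dist η α ^ 2 := by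
  obtain ⟨hr, hF, hs, hd⟩ := id hπ
  obtain ⟨w, hw, rfl⟩ := hs α
  obtain ⟨x, hx, rfl⟩ := hs β
  obtain ⟨y, hy, rfl⟩ := hs γ
  obtain ⟨z, hz, rfl⟩ := hs η
  have hlim := aux_quad hπ hw hx hy hz
  set o := π (fun _ => p)
  have hδ : Tendsto (fun n => delta4 p (w n) (x n) (y n) (z n) / r n) atTop
      (𝓝 (delta4 o (π w) (π x) (π y) (π z))) := by
    refine ((hd w hw _ hF.2.1).max ((hd x hx _ hF.2.1).max
      ((hd y hy _ hF.2.1).max (hd z hz _ hF.2.1)))).congr fun n => ?_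
    simp only [max_div_div_right (hr.1 n).le]
    rfl
  set D := delta4 o (π w) (π x) (π y) (π z)
  have hq : Tendsto (fun n => (w n, x n, y n, z n)) atTop (𝓝 (p, p, p, p)) :=
    (aux_tendsto_p hr hF hw).prodMk_nhds ((aux_tendsto_p hr hF hx).prodMk_nhds
      ((aux_tendsto_p hr hF hy).prodMk_nhds (aux_tendsto_p hr hF hz)))
  have hb : ∀ b < 0, b * D ^ 2 ≤ dist (π w) (π x) ^ 2 + dist (π x) (π y) ^ 2 +
      dist (π y) (π z) ^ 2 + dist (π z) (π w) ^ 2 - dist (π w) (π y) ^ 2 -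
      dist (π x) (π z) ^ 2 := by
    intro b hb
    refine le_of_tendsto_of_tendsto ((hδ.pow 2).const_mul b) hlim ?_
    filter_upwards [hq.eventually (hA b hb)] with n hn
    by_cases h : w n = p ∧ x n = p ∧ y n = p ∧ z n = p
    · obtain ⟨h1, h2, h3, h4⟩ := h
      simp [h1, h2, h3, h4, delta4]
    · have hpos := aux_delta_pos h
      rw [A1, if_neg h, le_div_iff₀ (by positivity)] at hn
      rw [div_pow, ← mul_div_assoc]
      exact div_le_div_of_nonneg_right hn (by positivity)
  have h0 : Tendsto (fun b : ℝ => b * D ^ 2) (𝓝[<] 0) (𝓝 (0 * D ^ 2)) :=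
    ((continuous_id.mul continuous_const).tendsto 0).mono_left nhdsWithin_le_nhds
  have h1 := le_of_tendsto h0 (eventually_nhdsWithin_of_forall (s := Set.Iio 0) hb)
  linarith

lemma aux_back_A1 (p : X)
    (H : ∀ (r : ℕ → ℝ) (F : Set (ℕ → X)) (Ω : Type u) [MetricSpace Ω]
        (π : (ℕ → X) → Ω), IsPretangentSpace p r F π →
        IsGeodesicSpace Ω ∧
          ∀ α β γ η : Ω, dist α γ ^ 2 + dist β η ^ 2 ≤
            dist α β ^ 2 + dist β γ ^ 2 + dist γ η ^ 2 + dist η α ^ 2) (b : ℝ) (hb : b < 0) :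
    ∀ᶠ q : X × X × X × X in 𝓝 (p, p, p, p), b ≤ A1 p q.1 q.2.1 q.2.2.1 q.2.2.2 := by
  by_contra hcon
  obtain ⟨q, hq, hqA⟩ := exists_seq_forall_of_frequently (not_eventually.1 hcon)
  have hne : ∀ n, ¬((q n).1 = p ∧ (q n).2.1 = p ∧ (q n).2.2.1 = p ∧ (q n).2.2.2 = p) := by
    intro n h
    apply hqA n
    rw [A1, if_pos h]
    exact hb.le
  let r : ℕ → ℝ := fun n => delta4 p (q n).1 (q n).2.1 (q n).2.2.1 (q n).2.2.2
  have hc : Continuous fun q : X × X × X × X => delta4 p q.1 q.2.1 q.2.2.1 q.2.2.2 := by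
    unfold delta4
    fun_prop
  have hr : IsNormalizingSeq r := by
    refine ⟨fun n => aux_delta_pos (hne n), ?_⟩
    have := (hc.tendsto (p, p, p, p)).comp hq
    have h0 : delta4 p p p p p = 0 := by simp [delta4]
    simp only [h0] at this
    exact this
  obtain ⟨φ, hφ, F, Ω, hΩ, π, hπ, hv⟩ := aux_pret p
    (![fun n => (q n).1, fun n => (q n).2.1, fun n => (q n).2.2.1, fun n => (q n).2.2.2] :
      Fin 4 → ℕ → X) r hr (by
      intro i n
      obtain ⟨h1, h2, h3, h4⟩ := aux_delta_le p (q n).1 (q n).2.1 (q n).2.2.1 (q n).2.2.2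
      fin_cases i
      · exact h1
      · exact h2
      · exact h3
      · exact h4)
  have hlim := aux_quad hπ (w := fun n => (q (φ n)).1) (x := fun n => (q (φ n)).2.1)
    (y := fun n => (q (φ n)).2.2.1) (z := fun n => (q (φ n)).2.2.2) (hv 0) (hv 1) (hv 2) (hv 3)
  have hquad := (H _ F Ω π hπ).2 (π fun n => (q (φ n)).1) (π fun n => (q (φ n)).2.1)
    (π fun n => (q (φ n)).2.2.1) (π fun n => (q (φ n)).2.2.2)
  have hle := le_of_tendsto hlim (b := b) (Eventually.of_forall fun n => by
    have := not_le.1 (hqA (φ n))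
    rw [A1, if_neg (hne _)] at this
    exact this.le)
  linarith [hquad]

lemma aux_back_mid (p : X)
    (H : ∀ (r : ℕ → ℝ) (F : Set (ℕ → X)) (Ω : Type u) [MetricSpace Ω]
        (π : (ℕ → X) → Ω), IsPretangentSpace p r F π → IsGeodesicSpace Ω) :
    MidpointConvexAt p := by
  intro x y hx hy
  have hP : ∀ k : ℕ, ∀ᶠ n in atTop, ∃ z : X, (x n = p ∧ y n = p → z = p) ∧
      |dist (x n) z - dist (x n) (y n) / 2| / max (dist (x n) p) (dist (y n) p)
        ≤ 1 / ((k : ℝ) + 1) ∧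
      |dist (y n) z - dist (x n) (y n) / 2| / max (dist (x n) p) (dist (y n) p)
        ≤ 1 / ((k : ℝ) + 1) := by
    intro k
    have hk : 0 < 1 / ((k : ℝ) + 1) := by positivity
    by_contra hcon
    obtain ⟨ψ, hψ, hno⟩ := extraction_of_frequently_atTop (not_eventually.1 hcon)
    have hne : ∀ n, ¬(x (ψ n) = p ∧ y (ψ n) = p) := by
      rintro n ⟨h1, h2⟩
      exact hno n ⟨p, fun _ => rfl, by simp only [h1, h2]; simpa using hk.le,
        by simp only [h1, h2]; simpa using hk.le⟩
    let r : ℕ → ℝ := fun n => max (dist (x (ψ n)) p) (dist (y (ψ n)) p)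
    have hr : IsNormalizingSeq r := by
      refine ⟨fun n => ?_, ?_⟩
      · by_contra hneg
        have h1 : dist (x (ψ n)) p ≤ 0 := (le_max_left _ _).trans (not_lt.1 hneg)
        have h2 : dist (y (ψ n)) p ≤ 0 := (le_max_right _ _).trans (not_lt.1 hneg)
        exact hne n ⟨dist_le_zero.1 h1, dist_le_zero.1 h2⟩
      · have h1 := ((tendsto_iff_dist_tendsto_zero.1 hx).max
          (tendsto_iff_dist_tendsto_zero.1 hy)).comp hψ.tendsto_atTop
        rw [max_self] at h1
        exact h1
    obtain ⟨φ, hφ, F, Ω, hΩ, π, hπ, hv⟩ := aux_pret p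
      (![fun n => x (ψ n), fun n => y (ψ n)] : Fin 2 → ℕ → X) r hr (by
        intro i n
        fin_cases i
        · exact le_max_left _ _
        · exact le_max_right _ _)
    have hxF : (fun n => x (ψ (φ n))) ∈ F := hv 0
    have hyF : (fun n => y (ψ (φ n))) ∈ F := hv 1
    obtain ⟨s, f, hf, -, hf0, hf1⟩ := H _ F Ω π hπ (π fun n => x (ψ (φ n))) (π fun n => y (ψ (φ n)))
    obtain ⟨hr', hF, hs, hd⟩ := hπ
    set L := dist (π fun n => x (ψ (φ n))) (π fun n => y (ψ (φ n))) with hLdef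
    have hL : 0 ≤ L := dist_nonneg
    have hmem : L / 2 ∈ Set.Icc 0 L := ⟨by linarith, by linarith⟩
    have e0 := hf 0 ⟨le_rfl, hL⟩ (L / 2) hmem
    have e1 := hf L ⟨hL, le_rfl⟩ (L / 2) hmem
    rw [abs_of_nonpos (by linarith), hf0] at e0
    rw [abs_of_nonneg (by linarith), hf1] at e1
    obtain ⟨z, hzF, hz⟩ := hs (f (L / 2))
    rw [← hz] at e0 e1
    have t0 := hd _ hxF z hzF
    have t1 := hd _ hyF z hzF
    have t2 := hd _ hxF _ hyF
    rw [← hLdef] at t2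
    rw [e0] at t0
    rw [e1] at t1
    have u0 := (t0.sub (t2.div_const 2)).abs
    have u1 := (t1.sub (t2.div_const 2)).abs
    have v0 := u0.eventually_lt_const (u := 1 / ((k : ℝ) + 1)) (by
      rw [abs_lt]; constructor <;> linarith)
    have v1 := u1.eventually_lt_const (u := 1 / ((k : ℝ) + 1)) (by
      rw [abs_lt]; constructor <;> linarith)
    obtain ⟨n, h0, h1⟩ := (v0.and v1).exists
    apply hno (φ n)
    have hrn : 0 < r (φ n) := hr.1 _
    have conv : ∀ a c : ℝ, |a - c / 2| / r (φ n) = |a / r (φ n) - c / r (φ n) / 2| := by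
      intro a c
      rw [← abs_of_pos hrn, ← abs_div, abs_of_pos hrn]
      congr 1
      ring
    refine ⟨z n, fun h => absurd h (hne _), ?_, ?_⟩
    · exact ((conv _ _).trans_lt h0).le
    · exact ((conv _ _).trans_lt h1).le
  obtain ⟨j, hj, hjP⟩ := aux_diag _ hP
  have : ∀ n, ∃ z : X, (∃ z : X, (x n = p ∧ y n = p → z = p) ∧
      |dist (x n) z - dist (x n) (y n) / 2| / max (dist (x n) p) (dist (y n) p)
        ≤ 1 / ((j n : ℝ) + 1) ∧
      |dist (y n) z - dist (x n) (y n) / 2| / max (dist (x n) p) (dist (y n) p)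
        ≤ 1 / ((j n : ℝ) + 1)) → ((x n = p ∧ y n = p → z = p) ∧
      |dist (x n) z - dist (x n) (y n) / 2| / max (dist (x n) p) (dist (y n) p)
        ≤ 1 / ((j n : ℝ) + 1) ∧
      |dist (y n) z - dist (x n) (y n) / 2| / max (dist (x n) p) (dist (y n) p)
        ≤ 1 / ((j n : ℝ) + 1)) := by
    intro n
    by_cases h : ∃ z : X, (x n = p ∧ y n = p → z = p) ∧
      |dist (x n) z - dist (x n) (y n) / 2| / max (dist (x n) p) (dist (y n) p)
        ≤ 1 / ((j n : ℝ) + 1) ∧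
      |dist (y n) z - dist (x n) (y n) / 2| / max (dist (x n) p) (dist (y n) p)
        ≤ 1 / ((j n : ℝ) + 1)
    · exact ⟨h.choose, fun _ => h.choose_spec⟩
    · exact ⟨p, fun h' => absurd h' h⟩
  choose z hz using this
  have hz' : ∀ᶠ n in atTop, _ := hjP.mono fun n hn => hz n hn
  have hlim : Tendsto (fun n => 1 / ((j n : ℝ) + 1)) atTop (𝓝 0) :=
    tendsto_one_div_add_atTop_nhds_zero_nat.comp hj
  have main : ∀ w : ℕ → X, (∀ᶠ n in atTop, (x n = p ∧ y n = p → z n = p ∧ w n = p) ∧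
      |dist (w n) (z n) - dist (x n) (y n) / 2| / max (dist (x n) p) (dist (y n) p)
        ≤ 1 / ((j n : ℝ) + 1)) →
      Tendsto (fun n => midQuot p (w n) (x n) (y n) (z n)) atTop (𝓝 (0 : EReal)) := by
    intro w hw
    have h1 : Tendsto (fun n => |dist (w n) (z n) - dist (x n) (y n) / 2| /
        max (dist (x n) p) (dist (y n) p)) atTop (𝓝 0) := by
      refine squeeze_zero' (Eventually.of_forall fun n => ?_) (hw.mono fun n hn => hn.2) hlim
      exact div_nonneg (abs_nonneg _) (dist_nonneg.trans (le_max_left _ _))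
    have h2 := EReal.tendsto_coe.2 h1
    refine Tendsto.congr' ?_ h2
    filter_upwards [hw] with n hn
    rw [midQuot]
    split_ifs with ha hb
    · simp [ha.1, ha.2]
    · exact absurd (hn.1 ha).1 hb
    · rfl
  refine ⟨z, main x ?_, main y ?_⟩
  · filter_upwards [hz'] with n hn
    exact ⟨fun h => ⟨hn.1 h, h.1⟩, hn.2.1⟩
  · filter_upwards [hz'] with n hn
    exact ⟨fun h => ⟨hn.1 h, h.2⟩, hn.2.2⟩

end Helpers2

/-- if every pretangent space is separable and tangent, then `X`
is midpoint convex at `p` with `liminf A₁ ≥ 0` iff every pretangent space is a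
geodesic space satisfying the quadrilateral inequality (nonpositive
Aleksandrov curvature). -/
theorem midpointConvex_and_liminf_A1_iff_pretangent_nonpos_curvature
    {X : Type u} [MetricSpace X] (p : X)
    (hst : ∀ (r : ℕ → ℝ) (F : Set (ℕ → X)) (Ω : Type u) [MetricSpace Ω]
      (π : (ℕ → X) → Ω), IsPretangentSpace p r F π →
      TopologicalSpace.SeparableSpace Ω ∧ IsTangentFamily p r F) :
    (MidpointConvexAt p ∧
        0 ≤ liminf (fun q : X × X × X × X => A1 p q.1 q.2.1 q.2.2.1 q.2.2.2)
            (𝓝 (p, p, p, p))) ↔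
      (∀ (r : ℕ → ℝ) (F : Set (ℕ → X)) (Ω : Type u) [MetricSpace Ω]
        (π : (ℕ → X) → Ω), IsPretangentSpace p r F π →
        IsGeodesicSpace Ω ∧
          ∀ α β γ η : Ω, dist α γ ^ 2 + dist β η ^ 2 ≤
            dist α β ^ 2 + dist β γ ^ 2 + dist γ η ^ 2 + dist η α ^ 2) := by
  constructor
  · rintro ⟨hmc, hA⟩ r F Ω _ π hπ
    obtain ⟨hsep, htan⟩ := hst r F Ω π hπ
    have := aux_complete hπ
    exact ⟨aux_menger (aux_midpoint hπ hmc hsep htan),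
      aux_forward_quad hπ ((aux_liminf p).1 hA)⟩
  · intro H
    exact ⟨aux_back_mid p fun r F Ω _ π hπ => (H r F Ω π hπ).1,
      (aux_liminf p).2 (aux_back_A1 p H)⟩
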